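/- Let 𝒜 and ℬ be typoids on A and B such that the product typoid 𝒜 × ℬ on A × B is univalent, and suppose B is pointed, i.e. there is a term b : B. Then 𝒜 is univalent. -/

import Mathlib

universe u u₁ u₂ u₃ v v₁ v₂ v₃

/-- A typoid structure on a type `A`: an equivalence `Eqv` with reflexivity terms `eqv`,
composition `comp`, inversion `inv`, and a second-level equivalence relation `Eqv2`
(reflexive, symmetric, transitive) satisfying the axioms Typ1-Typ4. -/
structure Typoid (A : Type u) where
  Eqv : A → A → Sort v
  eqv : ∀ x, Eqv x x
  comp : ∀ {x y z : A}, Eqv x y → Eqv y z → Eqv x z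
  inv : ∀ {x y : A}, Eqv x y → Eqv y x
  Eqv2 : ∀ {x y : A}, Eqv x y → Eqv x y → Prop
  refl2 : ∀ {x y : A} (e : Eqv x y), Eqv2 e e
  symm2 : ∀ {x y : A} {e d : Eqv x y}, Eqv2 e d → Eqv2 d e
  trans2 : ∀ {x y : A} {e d c : Eqv x y}, Eqv2 e d → Eqv2 d c → Eqv2 e c
  typ1_left : ∀ {x y : A} (e : Eqv x y), Eqv2 (comp (eqv x) e) e
  typ1_right : ∀ {x y : A} (e : Eqv x y), Eqv2 (comp e (eqv y)) e
  typ2_left : ∀ {x y : A} (e : Eqv x y), Eqv2 (comp e (inv e)) (eqv x)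
  typ2_right : ∀ {x y : A} (e : Eqv x y), Eqv2 (comp (inv e) e) (eqv y)
  typ3 : ∀ {x y z w : A} (e₁ : Eqv x y) (e₂ : Eqv y z) (e₃ : Eqv z w),
    Eqv2 (comp (comp e₁ e₂) e₃) (comp e₁ (comp e₂ e₃))
  typ4 : ∀ {x y z : A} {e₁ d₁ : Eqv x y} {e₂ d₂ : Eqv y z},
    Eqv2 e₁ d₁ → Eqv2 e₂ d₂ → Eqv2 (comp e₁ e₂) (comp d₁ d₂)

/-- `IdtoEqv`, defined by transport of the reflexivity term, so that
`T.idtoEqv rfl` is definitionally `T.eqv x`. -/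
def Typoid.idtoEqv {A : Type u} (T : Typoid.{u, v} A) {x y : A} (p : x = y) : T.Eqv x y :=
  p ▸ T.eqv x

/-- A typoid is univalent: there are `ua` and `ua2` inverting `idtoEqv` up to `Eqv2`. -/
structure Univalent {A : Type u} (T : Typoid.{u, v} A) : Prop where
  ua : ∀ (x y : A), T.Eqv x y → x = y
  ua2 : ∀ (x y : A) (e d : T.Eqv x y), T.Eqv2 e d → ua x y e = ua x y d
  ua_idtoEqv : ∀ (x y : A) (p : x = y), ua x y (T.idtoEqv p) = p
  idtoEqv_ua : ∀ (x y : A) (e : T.Eqv x y), T.Eqv2 (T.idtoEqv (ua x y e)) e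

/-- The componentwise product typoid on `A × B`. -/
def prodTypoid {A : Type u₁} {B : Type u₂} (S : Typoid.{u₁, v₁ + 1} A)
    (T : Typoid.{u₂, v₂ + 1} B) : Typoid.{max u₁ u₂, (max v₁ v₂) + 1} (A × B) where
  Eqv z w := S.Eqv z.1 w.1 × T.Eqv z.2 w.2
  eqv z := (S.eqv z.1, T.eqv z.2)
  comp e d := (S.comp e.1 d.1, T.comp e.2 d.2)
  inv e := (S.inv e.1, T.inv e.2)
  Eqv2 e d := S.Eqv2 e.1 d.1 ∧ T.Eqv2 e.2 d.2
  refl2 e := ⟨S.refl2 e.1, T.refl2 e.2⟩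
  symm2 h := ⟨S.symm2 h.1, T.symm2 h.2⟩
  trans2 h₁ h₂ := ⟨S.trans2 h₁.1 h₂.1, T.trans2 h₁.2 h₂.2⟩
  typ1_left e := ⟨S.typ1_left e.1, T.typ1_left e.2⟩
  typ1_right e := ⟨S.typ1_right e.1, T.typ1_right e.2⟩
  typ2_left e := ⟨S.typ2_left e.1, T.typ2_left e.2⟩
  typ2_right e := ⟨S.typ2_right e.1, T.typ2_right e.2⟩
  typ3 e₁ e₂ e₃ := ⟨S.typ3 e₁.1 e₂.1 e₃.1, T.typ3 e₁.2 e₂.2 e₃.2⟩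
  typ4 h₁ h₂ := ⟨S.typ4 h₁.1 h₂.1, T.typ4 h₁.2 h₂.2⟩

/-- The componentwise `IdtoEqv` of the product typoid. -/
def prodIdtoEqv {A : Type u₁} {B : Type u₂} (S : Typoid.{u₁, v₁ + 1} A)
    (T : Typoid.{u₂, v₂ + 1} B) (z w : A × B) (p : z = w) : (prodTypoid S T).Eqv z w :=
  (S.idtoEqv (congrArg Prod.fst p), T.idtoEqv (congrArg Prod.snd p))

/-- Proposition 4.8 (first part): if the product typoid `𝒜 × ℬ` is univalent (with respect to
the componentwise `IdtoEqv`) and `B` is pointed, then `𝒜` is univalent. -/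
theorem univalent_of_prod_left {A : Type u₁} {B : Type u₂} (S : Typoid.{u₁, v₁ + 1} A)
    (T : Typoid.{u₂, v₂ + 1} B) (b : B)
    (h : ∃ Ua : ∀ (z w : A × B), (prodTypoid S T).Eqv z w → z = w,
      (∀ (z w : A × B) (e d : (prodTypoid S T).Eqv z w),
        (prodTypoid S T).Eqv2 e d → Ua z w e = Ua z w d) ∧
      (∀ (z w : A × B) (p : z = w), Ua z w (prodIdtoEqv S T z w p) = p) ∧
      (∀ (z w : A × B) (e : (prodTypoid S T).Eqv z w),
        (prodTypoid S T).Eqv2 (prodIdtoEqv S T z w (Ua z w e)) e)) :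
    Univalent S := by
  obtain ⟨Ua, h2, hi, hu⟩ := h
  exact
    { ua := fun x y e => congrArg Prod.fst (Ua (x, b) (y, b) (e, T.eqv b))
      ua2 := fun x y e d hed => congrArg (congrArg Prod.fst)
        (h2 (x, b) (y, b) (e, T.eqv b) (d, T.eqv b) ⟨hed, T.refl2 _⟩)
      ua_idtoEqv := fun x y p => by
        subst p
        exact congrArg (congrArg Prod.fst) (hi (x, b) (x, b) rfl)
      idtoEqv_ua := fun x y e => (hu (x, b) (y, b) (e, T.eqv b)).1 }
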